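/- For every complex number q with |q| < 1, the infinite products ∏_{n=1}^∞ (1 + q^{2n−1})⁸, ∏_{n=1}^∞ (1 − q^{2n−1})⁸ and ∏_{n=1}^∞ (1 + q^{2n})⁸ converge, and ∏_{n=1}^∞ (1 + q^{2n−1})⁸ − ∏_{n=1}^∞ (1 − q^{2n−1})⁸ = 16·q·∏_{n=1}^∞ (1 + q^{2n})⁸. -/

import Mathlib

open Filter Topology

/-- Partial products of the Euler function in `q²`. -/
noncomputable def jaA (q : ℂ) (m : ℕ) : ℂ := ∏ i ∈ Finset.range m, (1 - q ^ (2 * i + 2))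

/-- Reciprocal of `jaA`, extended by zero to negative integers. -/
noncomputable def jaB (q : ℂ) : ℤ → ℂ
  | Int.ofNat m => (jaA q m)⁻¹
  | Int.negSucc _ => 0

lemma ja_factor_ne (q : ℂ) (hq : ‖q‖ < 1) (i : ℕ) : 1 - q ^ (2 * i + 2) ≠ 0 := by
  intro h
  have h1 : q ^ (2 * i + 2) = 1 := (sub_eq_zero.mp h).symm
  have h2 : ‖q‖ ^ (2 * i + 2) = 1 := by rw [← norm_pow, h1, norm_one]
  have h3 : ‖q‖ ^ (2 * i + 2) < 1 := pow_lt_one₀ (norm_nonneg _) hq (by omega)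
  linarith

lemma jaA_ne (q : ℂ) (hq : ‖q‖ < 1) (m : ℕ) : jaA q m ≠ 0 :=
  Finset.prod_ne_zero_iff.mpr fun i _ => ja_factor_ne q hq i

lemma jaA_succ (q : ℂ) (m : ℕ) : jaA q (m + 1) = jaA q m * (1 - q ^ (2 * m + 2)) := by
  simp [jaA, Finset.prod_range_succ]

lemma jaB_rec (q : ℂ) (hq : ‖q‖ < 1) (m : ℤ) :
    jaB q m = (1 - q ^ (2 * (m + 1))) * jaB q (m + 1) := by
  rcases m with m | m
  · have : (Int.ofNat m + 1 : ℤ) = Int.ofNat (m + 1) := rfl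
    rw [this]
    have e : (2 * Int.ofNat (m + 1) : ℤ) = ((2 * m + 2 : ℕ) : ℤ) := by
      simp; ring
    rw [e, zpow_natCast]
    simp only [jaB]
    rw [jaA_succ]
    have h1 := ja_factor_ne q hq m
    have h2 := jaA_ne q hq m
    field_simp
  · rcases m with _ | m
    · simp [jaB]
    · have : (Int.negSucc (m + 1) + 1 : ℤ) = Int.negSucc m := rfl
      rw [this]
      simp [jaB]

lemma ja_summable (q : ℂ) (hq : ‖q‖ < 1) (a : ℕ) : Summable fun i : ℕ => ‖q ^ (2 * i + a)‖ := by
  have h : Summable fun i : ℕ => (‖q‖ ^ 2) ^ i * ‖q‖ ^ a :=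
    (summable_geometric_of_lt_one (by positivity)
      (pow_lt_one₀ (norm_nonneg _) hq (by norm_num))).mul_right _
  refine h.congr fun i => ?_
  rw [norm_pow, pow_add, pow_mul]

lemma ja_mult (q z : ℂ) (hq : ‖q‖ < 1) (a : ℕ) :
    Multipliable fun i : ℕ => 1 + z * q ^ (2 * i + a) := by
  apply multipliable_one_add_of_summable
  simpa only [norm_mul] using (ja_summable q hq a).mul_left ‖z‖

/-- The full Euler product. -/
noncomputable def jaE (q : ℂ) : ℂ := ∏' i : ℕ, (1 - q ^ (2 * i + 2))

lemma jaE_ne (q : ℂ) (hq : ‖q‖ < 1) : jaE q ≠ 0 := by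
  have := tprod_one_add_ne_zero_of_summable (f := fun i : ℕ => -q ^ (2 * i + 2))
    (fun i => by simpa [sub_eq_add_neg] using ja_factor_ne q hq i)
    (by simpa only [norm_neg] using ja_summable q hq 2)
  simpa only [jaE, sub_eq_add_neg] using this

lemma jaA_tendsto (q : ℂ) (hq : ‖q‖ < 1) : Tendsto (jaA q) atTop (𝓝 (jaE q)) := by
  have := (ja_mult q (-1) hq 2).hasProd.tendsto_prod_nat
  simp only [neg_one_mul, ← sub_eq_add_neg] at this
  exact this

lemma jaB_tendsto (q : ℂ) (hq : ‖q‖ < 1) (k : ℤ) :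
    Tendsto (fun n : ℕ => jaB q (n + k)) atTop (𝓝 (jaE q)⁻¹) := by
  have h1 : Tendsto (fun m : ℕ => (jaA q m)⁻¹) atTop (𝓝 (jaE q)⁻¹) :=
    (jaA_tendsto q hq).inv₀ (jaE_ne q hq)
  have h2 : Tendsto (fun n : ℕ => ((n : ℤ) + k).toNat) atTop atTop := by
    rw [tendsto_atTop]
    intro b
    filter_upwards [eventually_ge_atTop (b + k.natAbs)] with n hn
    omega
  refine (h1.comp h2).congr' ?_
  filter_upwards [eventually_ge_atTop k.natAbs] with n hn
  obtain ⟨m, hm⟩ : ∃ m : ℕ, (n : ℤ) + k = m := ⟨((n : ℤ) + k).toNat, by omega⟩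
  simp only [Function.comp, hm, Int.toNat_natCast]
  rfl

lemma jaA_bound (q : ℂ) (hq : ‖q‖ < 1) : ∃ K, ∀ m, ‖jaA q m‖ ≤ K := by
  obtain ⟨K, hK⟩ := (Metric.isBounded_range_of_tendsto _ (jaA_tendsto q hq)).exists_norm_le
  exact ⟨K, fun m => hK _ ⟨m, rfl⟩⟩

lemma jaB_bound (q : ℂ) (hq : ‖q‖ < 1) : ∃ K, 0 ≤ K ∧ ∀ m, ‖jaB q m‖ ≤ K := by
  have h1 : Tendsto (fun m : ℕ => (jaA q m)⁻¹) atTop (𝓝 (jaE q)⁻¹) :=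
    (jaA_tendsto q hq).inv₀ (jaE_ne q hq)
  obtain ⟨K, hK⟩ := (Metric.isBounded_range_of_tendsto _ h1).exists_norm_le
  have h0 : 0 ≤ K := (norm_nonneg _).trans (hK _ ⟨0, rfl⟩)
  refine ⟨K, h0, fun m => ?_⟩
  rcases m with m | m
  · exact hK _ ⟨m, rfl⟩
  · simpa [jaB] using h0

/-- Coefficients of the finite triple product. -/
noncomputable def jaC (q : ℂ) (n : ℕ) (k : ℤ) : ℂ :=
  jaA q (2 * n) * q ^ (k ^ 2) * jaB q (n + k) * jaB q (n - k)

lemma jaC_rec (q : ℂ) (hq : ‖q‖ < 1) (h0 : q ≠ 0) (n : ℕ) (k : ℤ) :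
    jaC q (n + 1) k = (1 + q ^ (4 * n + 2)) * jaC q n k
      + q ^ (2 * n + 1) * jaC q n (k - 1) + q ^ (2 * n + 1) * jaC q n (k + 1) := by
  unfold jaC
  have a1 : jaB q (n + k) = _ := jaB_rec q hq _
  have a2 : jaB q (n + k - 1) = _ := jaB_rec q hq _
  have b1 : jaB q (n - k) = _ := jaB_rec q hq _
  have b2 : jaB q (n - k - 1) = _ := jaB_rec q hq _
  rw [sub_add_cancel] at a2 b2
  have e1 : (n : ℤ) + (k - 1) = n + k - 1 := by ring
  have e2 : (n : ℤ) - (k - 1) = n - k + 1 := by ring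
  have e3 : (n : ℤ) + (k + 1) = n + k + 1 := by ring
  have e4 : (n : ℤ) - (k + 1) = n - k - 1 := by ring
  have e5 : ((n + 1 : ℕ) : ℤ) + k = n + k + 1 := by push_cast; ring
  have e6 : ((n + 1 : ℕ) : ℤ) - k = n - k + 1 := by push_cast; ring
  rw [e1, e2, e3, e4, e5, e6, a2, b2, a1, b1, show 2 * (n + 1) = 2 * n + 1 + 1 by ring,
    jaA_succ, jaA_succ]
  generalize jaB q (n + k + 1) = X
  generalize jaB q (n - k + 1) = Y
  generalize jaA q (2 * n) = A
  have z1 : q ^ ((k - 1) ^ 2) = q ^ (k ^ 2) * (q ^ k)⁻¹ ^ 2 * q := by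
    rw [← zpow_neg, ← zpow_natCast, ← zpow_mul, ← zpow_add₀ h0, ← zpow_add_one₀ h0]
    congr 1; push_cast; ring
  have z2 : q ^ ((k + 1) ^ 2) = q ^ (k ^ 2) * (q ^ k) ^ 2 * q := by
    rw [← zpow_natCast (q ^ k), ← zpow_mul, ← zpow_add₀ h0, ← zpow_add_one₀ h0]
    congr 1; push_cast; ring
  have z3 : q ^ (2 * ((n : ℤ) + k)) = (q ^ n) ^ 2 * (q ^ k) ^ 2 := by
    rw [← mul_pow, ← zpow_natCast q n, ← zpow_add₀ h0, ← zpow_natCast, ← zpow_mul]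
    congr 1; push_cast; ring
  have z4 : q ^ (2 * ((n : ℤ) + k + 1)) = (q ^ n) ^ 2 * (q ^ k) ^ 2 * q ^ 2 := by
    rw [← z3, ← zpow_natCast, ← zpow_add₀ h0]
    congr 1; push_cast; ring
  have z5 : q ^ (2 * ((n : ℤ) - k)) = (q ^ n) ^ 2 * (q ^ k)⁻¹ ^ 2 := by
    rw [← mul_pow, ← zpow_neg, ← zpow_natCast q n, ← zpow_add₀ h0, ← zpow_natCast, ← zpow_mul]
    congr 1; push_cast; ring
  have z6 : q ^ (2 * ((n : ℤ) - k + 1)) = (q ^ n) ^ 2 * (q ^ k)⁻¹ ^ 2 * q ^ 2 := by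
    rw [← z5, ← zpow_natCast, ← zpow_add₀ h0]
    congr 1; push_cast; ring
  have y1 : q ^ (4 * n + 2) = (q ^ n) ^ 4 * q ^ 2 := by ring
  have y2 : q ^ (2 * n + 1) = (q ^ n) ^ 2 * q := by ring
  have y3 : q ^ (2 * (2 * n) + 2) = (q ^ n) ^ 4 * q ^ 2 := by ring
  have y4 : q ^ (2 * (2 * n + 1) + 2) = (q ^ n) ^ 4 * q ^ 4 := by ring
  rw [z1, z2, z3, z4, z5, z6, y1, y2, y3, y4]
  have hw : q ^ k ≠ 0 := zpow_ne_zero _ h0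
  generalize q ^ k = w at *
  generalize q ^ n = u at *
  generalize q ^ (k ^ 2) = t at *
  field_simp
  ring

lemma jaC_hasSum (q z : ℂ) (hq : ‖q‖ < 1) (h0 : q ≠ 0) (hz : z ≠ 0) (n : ℕ) :
    HasSum (fun k : ℤ => jaC q n k * z ^ k)
      (∏ i ∈ Finset.range n, ((1 + z * q ^ (2 * i + 1)) * (1 + z⁻¹ * q ^ (2 * i + 1)))) := by
  induction n with
  | zero =>
    have : (∏ i ∈ Finset.range 0, ((1 + z * q ^ (2 * i + 1)) * (1 + z⁻¹ * q ^ (2 * i + 1))))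
        = (fun k : ℤ => jaC q 0 k * z ^ k) 0 := by
      have : jaB q 0 = 1 := by
        change (jaA q 0)⁻¹ = 1
        simp [jaA]
      simp [jaC, jaA, this]
    rw [this]
    apply hasSum_single
    intro k hk
    rcases k with k | k
    · rcases k with _ | k
      · simp at hk
      · have : ((0 : ℕ) : ℤ) - Int.ofNat (k + 1) = Int.negSucc k := by simp [Int.negSucc_eq]
        simp only [jaC, this]
        simp [jaB]
    · have : ((0 : ℕ) : ℤ) + Int.negSucc k = Int.negSucc k := by simp
      simp only [jaC, this]
      simp [jaB]
  | succ n ih =>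
    have s1 := (Equiv.subRight (1 : ℤ)).hasSum_iff.mpr ih
    have s2 := (Equiv.addRight (1 : ℤ)).hasSum_iff.mpr ih
    have s := ((ih.mul_left (1 + q ^ (4 * n + 2))).add (s1.mul_left (q ^ (2 * n + 1) * z))).add
      (s2.mul_left (q ^ (2 * n + 1) * z⁻¹))
    rw [Finset.prod_range_succ]
    have hval : ∀ P : ℂ, (1 + q ^ (4 * n + 2)) * P + q ^ (2 * n + 1) * z * P
        + q ^ (2 * n + 1) * z⁻¹ * P
        = P * ((1 + z * q ^ (2 * n + 1)) * (1 + z⁻¹ * q ^ (2 * n + 1))) := by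
      intro P
      field_simp
      ring
    rw [hval] at s
    refine cast (congrArg (fun f => HasSum f _) (funext fun k => ?_)) s
    symm
    simp only [Function.comp, Equiv.subRight_apply, Equiv.coe_addRight]
    rw [jaC_rec q hq h0, zpow_sub_one₀ hz, zpow_add_one₀ hz]
    field_simp

/-- Jacobi triple product. -/
lemma ja_triple (q z : ℂ) (hq : ‖q‖ < 1) (h0 : q ≠ 0) (hz : z ≠ 0)
    (hs : Summable fun k : ℤ => ‖q ^ (k ^ 2) * z ^ k‖) :
    ∑' k : ℤ, q ^ (k ^ 2) * z ^ k = jaE q * (∏' i : ℕ, (1 + z * q ^ (2 * i + 1)))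
      * ∏' i : ℕ, (1 + z⁻¹ * q ^ (2 * i + 1)) := by
  obtain ⟨K, hK⟩ := jaA_bound q hq
  obtain ⟨L, hL0, hL⟩ := jaB_bound q hq
  have hK0 : 0 ≤ K := (norm_nonneg _).trans (hK 0)
  have t1 : Tendsto (fun n : ℕ => ∑' k : ℤ, jaC q n k * z ^ k) atTop
      (𝓝 (∑' k : ℤ, (jaE q)⁻¹ * (q ^ (k ^ 2) * z ^ k))) := by
    apply tendsto_tsum_of_dominated_convergence (hs.mul_left (K * L * L))
    · intro k
      have hA : Tendsto (fun n : ℕ => jaA q (2 * n)) atTop (𝓝 (jaE q)) :=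
        (jaA_tendsto q hq).comp (tendsto_id.const_mul_atTop' (by norm_num))
      have hB1 := jaB_tendsto q hq k
      have hB2 := jaB_tendsto q hq (-k)
      have := ((hA.mul hB1).mul hB2).mul_const (q ^ (k ^ 2) * z ^ k)
      rw [mul_inv_cancel₀ (jaE_ne q hq), one_mul] at this
      refine this.congr fun n => ?_
      simp only [jaC, sub_eq_add_neg]
      ring
    · refine Eventually.of_forall fun n k => ?_
      have : jaC q n k * z ^ k =
          jaA q (2 * n) * jaB q (n + k) * jaB q (n - k) * (q ^ (k ^ 2) * z ^ k) := by
        simp only [jaC]; ring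
      rw [this, norm_mul, norm_mul, norm_mul]
      gcongr
      · exact hK _
      · exact hL _
      · exact hL _
  have t2 : Tendsto (fun n : ℕ => ∑' k : ℤ, jaC q n k * z ^ k) atTop
      (𝓝 ((∏' i : ℕ, (1 + z * q ^ (2 * i + 1))) * ∏' i : ℕ, (1 + z⁻¹ * q ^ (2 * i + 1)))) := by
    refine ((ja_mult q z hq 1).hasProd.tendsto_prod_nat.mul
      (ja_mult q z⁻¹ hq 1).hasProd.tendsto_prod_nat).congr fun n => ?_
    rw [(jaC_hasSum q z hq h0 hz n).tsum_eq, Finset.prod_mul_distrib]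
  have h := tendsto_nhds_unique t1 t2
  rw [tsum_mul_left] at h
  rw [mul_assoc, ← h, mul_inv_cancel_left₀ (jaE_ne q hq)]

lemma ja_geom (r : ℝ) (h0 : 0 ≤ r) (h1 : r < 1) : Summable fun k : ℤ => r ^ k.natAbs := by
  apply Summable.of_nat_of_neg <;> simpa using summable_geometric_of_lt_one h0 h1

lemma ja_sum (q : ℂ) (hq : ‖q‖ < 1) (h0 : q ≠ 0) (f : ℤ → ℤ)
    (hf : ∀ k : ℤ, (k.natAbs : ℤ) - 1 ≤ f k) : Summable fun k : ℤ => ‖q ^ f k‖ := by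
  have hp : 0 < ‖q‖ := norm_pos_iff.mpr h0
  refine Summable.of_nonneg_of_le (fun _ => norm_nonneg _) (fun k => ?_)
    ((ja_geom ‖q‖ (norm_nonneg _) hq).mul_right ‖q‖⁻¹)
  rw [norm_zpow, ← zpow_natCast, ← zpow_sub_one₀ hp.ne']
  exact zpow_le_zpow_right_of_le_one₀ hp hq.le (hf k)

/-- Theta constants. -/
noncomputable def jaT3 (q : ℂ) : ℂ := ∑' k : ℤ, q ^ (k ^ 2)

/-- Theta constants. -/
noncomputable def jaT2 (q : ℂ) : ℂ := ∑' k : ℤ, q ^ (k ^ 2 + k)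

lemma jaT3_sum (q : ℂ) (hq : ‖q‖ < 1) (h0 : q ≠ 0) : Summable fun k : ℤ => ‖q ^ (k ^ 2)‖ := by
  refine ja_sum q hq h0 _ fun k => ?_
  rw [Int.natCast_natAbs]
  nlinarith [sq_abs k, sq_nonneg (|k| - 1), abs_nonneg k]

lemma jaT2_sum (q : ℂ) (hq : ‖q‖ < 1) (h0 : q ≠ 0) : Summable fun k : ℤ => ‖q ^ (k ^ 2 + k)‖ := by
  refine ja_sum q hq h0 _ fun k => ?_
  rw [Int.natCast_natAbs]
  nlinarith [sq_abs k, sq_nonneg (|k| - 1), neg_abs_le k]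

lemma jaT3_prod (q : ℂ) (hq : ‖q‖ < 1) (h0 : q ≠ 0) :
    jaT3 q = jaE q * (∏' i : ℕ, (1 + q ^ (2 * i + 1))) ^ 2 := by
  have := ja_triple q 1 hq h0 one_ne_zero (by simpa using jaT3_sum q hq h0)
  simp only [one_zpow, mul_one, one_mul, inv_one] at this
  rw [jaT3, this]; ring

lemma jaT2_prod (q : ℂ) (hq : ‖q‖ < 1) (h0 : q ≠ 0) :
    jaT2 q = 2 * jaE q * (∏' i : ℕ, (1 + q ^ (2 * i + 2))) ^ 2 := by
  have e : ∀ k : ℤ, q ^ (k ^ 2) * q ^ k = q ^ (k ^ 2 + k) := fun k => (zpow_add₀ h0 _ _).symm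
  have := ja_triple q q hq h0 h0 (by simpa only [e] using jaT2_sum q hq h0)
  simp only [e] at this
  have e1 : ∀ i : ℕ, q * q ^ (2 * i + 1) = q ^ (2 * i + 2) := fun i => by ring
  have e2 : ∀ i : ℕ, q⁻¹ * q ^ (2 * i + 1) = q ^ (2 * i) := fun i => by
    rw [pow_succ]; field_simp
  simp only [e1, e2] at this
  have hm : Multipliable fun i : ℕ => 1 + q ^ (2 * i + 2) := by
    simpa only [one_mul] using ja_mult q 1 hq 2
  have e3 : ∏' i : ℕ, (1 + q ^ (2 * i)) = 2 * ∏' i : ℕ, (1 + q ^ (2 * i + 2)) := by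
    rw [tprod_eq_zero_mul' (f := fun i : ℕ => 1 + q ^ (2 * i)) hm]
    norm_num [mul_add]
  rw [jaT2, this, e3]; ring

lemma ja_split (f : ℤ × ℤ → ℂ) (hf : Summable f) :
    ∑' p, f p = (∑' p : ℤ × ℤ, f (p.1 + p.2, p.1 - p.2))
      + ∑' p : ℤ × ℤ, f (p.1 + p.2 + 1, p.1 - p.2) := by
  let g : (ℤ × ℤ) ⊕ (ℤ × ℤ) → ℤ × ℤ :=
    Sum.elim (fun p => (p.1 + p.2, p.1 - p.2)) (fun p => (p.1 + p.2 + 1, p.1 - p.2))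
  have hg : Function.Bijective g := by
    constructor
    · rintro (⟨a, b⟩ | ⟨a, b⟩) (⟨c, d⟩ | ⟨c, d⟩) h <;>
        simp only [g, Sum.elim_inl, Sum.elim_inr, Prod.mk.injEq] at h
      · congr 2 <;> omega
      · omega
      · omega
      · congr 2 <;> omega
    · rintro ⟨a, b⟩
      rcases Int.emod_two_eq_zero_or_one (a + b) with h | h
      · refine ⟨Sum.inl ((a + b) / 2, (a - b) / 2), ?_⟩
        simp only [g, Sum.elim_inl, Prod.mk.injEq]
        omega
      · refine ⟨Sum.inr ((a + b - 1) / 2, (a - b - 1) / 2), ?_⟩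
        simp only [g, Sum.elim_inr, Prod.mk.injEq]
        omega
  let e := Equiv.ofBijective g hg
  have hs : Summable (f ∘ e) := e.summable_iff.mpr hf
  have h1 : Summable ((f ∘ e) ∘ Sum.inl) := hs.comp_injective Sum.inl_injective
  have h2 : Summable ((f ∘ e) ∘ Sum.inr) := hs.comp_injective Sum.inr_injective
  rw [← e.tsum_eq f]
  exact (h1.hasSum.sum h2.hasSum).tsum_eq

lemma ja_norm_sq (q : ℂ) (hq : ‖q‖ < 1) : ‖q ^ 2‖ < 1 := by
  rw [norm_pow]; exact pow_lt_one₀ (norm_nonneg _) hq (by norm_num)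

lemma ja_sq_zpow (q : ℂ) (m : ℤ) : (q ^ 2) ^ m = q ^ (2 * m) := by
  rw [zpow_mul]; norm_cast

lemma jaT3_sq (q : ℂ) (hq : ‖q‖ < 1) (h0 : q ≠ 0) :
    jaT3 q ^ 2 = jaT3 (q ^ 2) ^ 2 + q * jaT2 (q ^ 2) ^ 2 := by
  have hq2 := ja_norm_sq q hq
  have h02 : q ^ 2 ≠ 0 := pow_ne_zero _ h0
  have s := jaT3_sum q hq h0
  have s3 := jaT3_sum _ hq2 h02
  have s2 := jaT2_sum _ hq2 h02
  rw [sq (jaT3 q), sq (jaT3 _), sq (jaT2 _), jaT3, jaT3, jaT2, tsum_mul_tsum_of_summable_norm s s,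
    tsum_mul_tsum_of_summable_norm s3 s3, tsum_mul_tsum_of_summable_norm s2 s2,
    ja_split _ (s.mul_norm s).of_norm, ← tsum_mul_left]
  congr 1 <;> refine tsum_congr fun p => ?_
  · simp only [ja_sq_zpow, ← zpow_add₀ h0]
    congr 1; ring
  · simp only [ja_sq_zpow, ← zpow_add₀ h0, ← zpow_one_add₀ h0]
    congr 1; ring

lemma jaT2_sq (q : ℂ) (hq : ‖q‖ < 1) (h0 : q ≠ 0) :
    jaT2 q ^ 2 = 2 * (jaT2 (q ^ 2) * jaT3 (q ^ 2)) := by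
  have hq2 := ja_norm_sq q hq
  have h02 : q ^ 2 ≠ 0 := pow_ne_zero _ h0
  have s := jaT2_sum q hq h0
  have s3 := jaT3_sum _ hq2 h02
  have s2 := jaT2_sum _ hq2 h02
  have hc : 2 * (jaT2 (q ^ 2) * jaT3 (q ^ 2))
      = jaT2 (q ^ 2) * jaT3 (q ^ 2) + jaT3 (q ^ 2) * jaT2 (q ^ 2) := by ring
  rw [hc, sq (jaT2 q), jaT2, jaT2, jaT3, tsum_mul_tsum_of_summable_norm s s,
    tsum_mul_tsum_of_summable_norm s3 s2, tsum_mul_tsum_of_summable_norm s2 s3,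
    ja_split _ (s.mul_norm s).of_norm]
  congr 1
  · refine tsum_congr fun p => ?_
    simp only [ja_sq_zpow, ← zpow_add₀ h0]
    congr 1; ring
  · rw [← ((Equiv.addRight (1 : ℤ)).prodCongr (Equiv.refl ℤ)).tsum_eq
      (fun z : ℤ × ℤ => (q ^ 2) ^ (z.1 ^ 2) * (q ^ 2) ^ (z.2 ^ 2 + z.2))]
    refine tsum_congr fun p => ?_
    simp only [ja_sq_zpow, ← zpow_add₀ h0, Equiv.prodCongr_apply, Prod.map, Equiv.coe_addRight,
      Equiv.refl_apply]
    congr 1; ring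

lemma ja_quartic (q : ℂ) (hq : ‖q‖ < 1) (h0 : q ≠ 0) :
    jaT3 q ^ 4 - jaT3 (-q) ^ 4 = q * jaT2 q ^ 4 := by
  have h1 := jaT3_sq q hq h0
  have h2 := jaT3_sq (-q) (by simpa using hq) (neg_ne_zero.mpr h0)
  have h3 := jaT2_sq q hq h0
  rw [neg_sq] at h2
  calc jaT3 q ^ 4 - jaT3 (-q) ^ 4 = (jaT3 q ^ 2) ^ 2 - (jaT3 (-q) ^ 2) ^ 2 := by ring
    _ = q * (jaT2 q ^ 2) ^ 2 := by rw [h1, h2, h3]; ring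
    _ = _ := by ring

/-- Jacobi's *aequatio identica satis abstrusa*: for `|q| < 1`,
`∏ (1 + q^{2n−1})⁸ − ∏ (1 − q^{2n−1})⁸ = 16·q·∏ (1 + q^{2n})⁸`,
all three products converging. -/
theorem jacobi_abstruse_identity (q : ℂ) (hq : ‖q‖ < 1) :
    Multipliable (fun n : ℕ => (1 + q ^ (2 * n + 1)) ^ 8) ∧
    Multipliable (fun n : ℕ => (1 - q ^ (2 * n + 1)) ^ 8) ∧
    Multipliable (fun n : ℕ => (1 + q ^ (2 * n + 2)) ^ 8) ∧
    (∏' n : ℕ, (1 + q ^ (2 * n + 1)) ^ 8) - (∏' n : ℕ, (1 - q ^ (2 * n + 1)) ^ 8)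
      = 16 * q * ∏' n : ℕ, (1 + q ^ (2 * n + 2)) ^ 8 := by
  have m1 : Multipliable (fun n : ℕ => 1 + q ^ (2 * n + 1)) := by
    simpa only [one_mul] using ja_mult q 1 hq 1
  have m2 : Multipliable (fun n : ℕ => 1 - q ^ (2 * n + 1)) := by
    simpa only [neg_one_mul, ← sub_eq_add_neg] using ja_mult q (-1) hq 1
  have m3 : Multipliable (fun n : ℕ => 1 + q ^ (2 * n + 2)) := by
    simpa only [one_mul] using ja_mult q 1 hq 2
  refine ⟨m1.pow 8, m2.pow 8, m3.pow 8, ?_⟩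
  rcases eq_or_ne q 0 with rfl | h0
  · simp
  rw [m1.tprod_pow, m2.tprod_pow, m3.tprod_pow]
  have hE := jaE_ne q hq
  have h := ja_quartic q hq h0
  rw [jaT3_prod q hq h0, jaT3_prod (-q) (by simpa using hq) (neg_ne_zero.mpr h0),
    jaT2_prod q hq h0] at h
  have e1 : jaE (-q) = jaE q := by
    unfold jaE
    refine tprod_congr fun i => ?_
    rw [Even.neg_pow ⟨i + 1, by ring⟩]
  have e2 : ∏' i : ℕ, (1 + (-q) ^ (2 * i + 1)) = ∏' i : ℕ, (1 - q ^ (2 * i + 1)) := by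
    refine tprod_congr fun i => ?_
    rw [Odd.neg_pow ⟨i, rfl⟩, sub_eq_add_neg]
  rw [e1, e2] at h
  apply mul_left_cancel₀ (pow_ne_zero 4 hE)
  linear_combination h
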